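/- Let k ≥ 3 be an integer, set h = (2k)^{2k²+1} and α = 32·(h+2)!·k^{h+2}. Let X be a finite set of size n ≥ 1, let F ⊆ 2^X be a weakly-k-cross-free family, and let {C_i}_{i ∈ I_0} be a collection of pairwise disjoint continuous chains in F, each of size h + 1, with |I_0| ≥ α·n. For i ∈ I_0 let X_i denote the set of h elements of X obtained as the difference between the largest and the smallest member of C_i (so each member of C_i equals the smallest member union an initial segment of these added elements), and for x ∈ X_i let C_i(x) denote the largest member of C_i not containing x. Then there exists a subset I ⊆ I_0 with |I| ≥ (k·h + 1)·n and a linear order ≺ on X such that: (C1) if i, j ∈ I and x ∈ X_i ∩ X_j, then C_i(x) and C_j(x) are comparable under inclusion; (C2) if i ∈ I and x, y ∈ X_i with x ≺ y, then C_i(x) ⊆ C_i(y); (C3) if i, j ∈ I are distinct and X_i ∩ X_j ≠ ∅, then either every member of C_i has smaller size than every member of C_j, or every member of C_j has smaller size than every member of C_i; (C4) if i ∈ I, then every member of C_i has size at least 3·k·h. -/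

import Mathlib

open Finset

/-- Two subsets `A` and `B` are weakly-crossing if none of the three sets
`A ∩ B`, `A \ B`, `B \ A` is empty. -/
def WeaklyCrossing {α : Type*} [DecidableEq α] (A B : Finset α) : Prop :=
  (A ∩ B).Nonempty ∧ (A \ B).Nonempty ∧ (B \ A).Nonempty

/-- A family is weakly-`k`-cross-free if it contains no `k` members that are
pairwise weakly-crossing. -/
def WeaklyCrossFreeFam {α : Type*} [DecidableEq α] (k : ℕ)
    (F : Finset (Finset α)) : Prop :=
  ¬ ∃ S : Finset (Finset α), S ⊆ F ∧ S.card = k ∧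
      (S : Set (Finset α)).Pairwise WeaklyCrossing

/-- `C` is a continuous chain: its members can be enumerated as
`A_1 ⊆ A_2 ⊆ … ⊆ A_s` with `|A_{i+1}| = |A_i| + 1` for each `i`. -/
def IsContinuousChain {α : Type*} [DecidableEq α] (C : Finset (Finset α)) : Prop :=
  ∃ f : ℕ → Finset α,
    (∀ n < C.card, f n ∈ C) ∧
    (∀ A ∈ C, ∃ n < C.card, f n = A) ∧
    (∀ n, n + 1 < C.card → f n ⊆ f (n + 1) ∧ (f (n + 1)).card = (f n).card + 1)

/-- Dilworth's theorem: a finite subset of a partial order in which every antichain has at most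
`w` elements can be partitioned into `w` chains. -/
theorem exists_chain_coloring {β : Type*} [PartialOrder β] [DecidableEq β] (P : Finset β) (w : ℕ)
    (hw : ∀ S ⊆ P, IsAntichain (· ≤ ·) (S : Set β) → S.card ≤ w) :
    ∃ f : β → ℕ, (∀ x ∈ P, f x < w) ∧ ∀ x ∈ P, ∀ y ∈ P, f x = f y → x ≤ y ∨ y ≤ x := by
  classical
  induction P using Finset.strongInduction generalizing w with
  | H P ih =>
  rcases P.eq_empty_or_nonempty with rfl | hP
  · exact ⟨fun _ => 0, by simp, by simp⟩
  obtain ⟨a, ha⟩ := P.exists_maximal hP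
  obtain ⟨v, rfl⟩ : ∃ v, w = v + 1 := by
    have := hw {a} (by simpa using ha.1) (by simp)
    exact ⟨w - 1, by simp at this; omega⟩
  by_cases hv : ∀ S ⊆ P.erase a, IsAntichain (· ≤ ·) (S : Set β) → S.card ≤ v
  · obtain ⟨f, hf, hf'⟩ := ih _ (erase_ssubset ha.1) v hv
    refine ⟨fun x => if x = a then v else f x, fun x hx => ?_, fun x hx y hy hxy => ?_⟩
    · have := fun h : x ≠ a => hf x (mem_erase.2 ⟨h, hx⟩)
      grind
    · have h1 := fun h : x ≠ a => hf x (mem_erase.2 ⟨h, hx⟩)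
      have h2 := fun h : y ≠ a => hf y (mem_erase.2 ⟨h, hy⟩)
      have h3 := fun (h : x ≠ a) (h' : y ≠ a) =>
        hf' x (mem_erase.2 ⟨h, hx⟩) y (mem_erase.2 ⟨h', hy⟩)
      by_cases hxa : x = a <;> by_cases hya : y = a <;> simp_all
  push Not at hv
  obtain ⟨S₀, hS₀, hS₀a, hS₀v⟩ := hv
  obtain ⟨f, hf, hf'⟩ := ih _ (erase_ssubset ha.1) (v + 1)
    fun S hS => hw S (hS.trans (erase_subset _ _))
  have hit : ∀ S ⊆ P.erase a, IsAntichain (· ≤ ·) (S : Set β) → v < S.card →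
      ∀ c < v + 1, ∃ y ∈ S, f y = c := by
    intro S hS hSa hSv c hc
    have hinj : Set.InjOn f S := by
      intro x hx y hy hxy
      by_contra hne
      rcases hf' x (hS hx) y (hS hy) hxy with h | h
      · exact hSa hx hy hne h
      · exact hSa hy hx (Ne.symm hne) h
    have himg : S.image f = range (v + 1) := by
      apply eq_of_subset_of_card_le
      · intro c hc
        obtain ⟨y, hy, rfl⟩ := mem_image.1 hc
        exact mem_range.2 (hf y (hS hy))
      · rw [card_range, card_image_of_injOn hinj]
        exact hSv
    have : c ∈ S.image f := himg ▸ mem_range.2 hc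
    simpa using this
  have top : ∀ c, ∃ t, c < v + 1 → t ∈ P.erase a ∧ f t = c ∧
      (∃ S ⊆ P.erase a, IsAntichain (· ≤ ·) (S : Set β) ∧ v < S.card ∧ t ∈ S) ∧
      ∀ S ⊆ P.erase a, IsAntichain (· ≤ ·) (S : Set β) → v < S.card →
        ∀ y ∈ S, f y = c → y ≤ t := by
    intro c
    by_cases hc : c < v + 1
    swap
    · exact ⟨a, fun h => absurd h hc⟩
    obtain ⟨y₀, hy₀, hy₀c⟩ := hit S₀ hS₀ hS₀a hS₀v c hc
    let Q := (P.erase a).filter fun t => f t = c ∧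
      ∃ S ⊆ P.erase a, IsAntichain (· ≤ ·) (S : Set β) ∧ v < S.card ∧ t ∈ S
    have hQ : Q.Nonempty :=
      ⟨y₀, mem_filter.2 ⟨hS₀ hy₀, hy₀c, S₀, hS₀, hS₀a, hS₀v, hy₀⟩⟩
    obtain ⟨t, ht⟩ := Q.exists_maximal hQ
    have ht1 := mem_filter.1 ht.1
    refine ⟨t, fun _ => ⟨ht1.1, ht1.2.1, ht1.2.2, fun S hS hSa hSv y hy hyc => ?_⟩⟩
    have hyQ : y ∈ Q := mem_filter.2 ⟨hS hy, hyc, S, hS, hSa, hSv, hy⟩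
    rcases hf' y (hS hy) t ht1.1 (by rw [hyc, ht1.2.1]) with h | h
    · exact h
    · exact ht.2 hyQ h
  choose t ht using top
  have ht_anti : ∀ c < v + 1, ∀ d < v + 1, c ≠ d → ¬ t c ≤ t d := by
    intro c hc d hd hcd hle
    obtain ⟨S, hS, hSa, hSv, htS⟩ := (ht d hd).2.2.1
    obtain ⟨y, hy, hyc⟩ := hit S hS hSa hSv c hc
    have hyt := (ht c hc).2.2.2 S hS hSa hSv y hy hyc
    refine hSa hy htS (fun h => hcd ?_) (hyt.trans hle)
    rw [← hyc, h, (ht d hd).2.1]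
  obtain ⟨c, hc, hca⟩ : ∃ c < v + 1, t c ≤ a := by
    by_contra! hcon
    have hinj : Set.InjOn t (range (v + 1)) := by
      intro c hc d hd hcd
      by_contra hne
      exact ht_anti c (by simpa using hc) d (by simpa using hd) hne hcd.le
    have hnot : a ∉ (range (v + 1)).image t := by
      intro h
      obtain ⟨c, hc, hca⟩ := mem_image.1 h
      exact hcon c (mem_range.1 hc) hca.le
    have := hw (insert a ((range (v + 1)).image t)) ?_ ?_
    · rw [card_insert_of_notMem hnot, card_image_of_injOn hinj, card_range] at this
      omega
    · intro x hx
      rcases mem_insert.1 hx with rfl | hx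
      · exact ha.1
      · obtain ⟨c, hc, rfl⟩ := mem_image.1 hx
        exact mem_of_mem_erase (ht c (mem_range.1 hc)).1
    · intro x hx y hy hxy hle
      simp only [coe_insert, coe_image, coe_range, Set.mem_insert_iff, Set.mem_image,
        Set.mem_Iio] at hx hy
      rcases hx with rfl | ⟨c, hc, rfl⟩ <;> rcases hy with rfl | ⟨d, hd, rfl⟩
      · exact hxy rfl
      · exact hcon d hd (ha.2 (mem_of_mem_erase (ht d hd).1) hle)
      · exact hcon c hc hle
      · exact ht_anti c hc d hd (fun h => hxy (by rw [h])) hle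
  let K := insert a ((P.erase a).filter fun x => f x = c ∧ x ≤ t c)
  have haK : a ∈ K := mem_insert_self _ _
  have hK : ∀ x ∈ K, ∀ y ∈ K, x ≤ y ∨ y ≤ x := by
    intro x hx y hy
    rcases mem_insert.1 hx with rfl | hx <;> rcases mem_insert.1 hy with rfl | hy
    · exact Or.inl le_rfl
    · exact Or.inr ((mem_filter.1 hy).2.2.trans hca)
    · exact Or.inl ((mem_filter.1 hx).2.2.trans hca)
    · have hx := mem_filter.1 hx
      have hy := mem_filter.1 hy
      exact hf' x hx.1 y hy.1 (hx.2.1.trans hy.2.1.symm)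
  have hlt : P \ K ⊂ P :=
    ⟨sdiff_subset, fun h => (mem_sdiff.1 (h ha.1)).2 haK⟩
  obtain ⟨g, hg, hg'⟩ := ih _ hlt v (by
    intro S hS hSa
    by_contra! hSv
    have hSP : S ⊆ P.erase a := fun x hx => by
      have := mem_sdiff.1 (hS hx)
      exact mem_erase.2 ⟨fun h => this.2 (h ▸ haK), this.1⟩
    obtain ⟨y, hy, hyc⟩ := hit S hSP hSa hSv c hc
    exact (mem_sdiff.1 (hS hy)).2 (mem_insert_of_mem
      (mem_filter.2 ⟨hSP hy, hyc, (ht c hc).2.2.2 S hSP hSa hSv y hy hyc⟩)))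
  refine ⟨fun x => if x ∈ K then v else g x, fun x hx => ?_, fun x hx y hy hxy => ?_⟩
  · have := fun h : x ∉ K => hg x (mem_sdiff.2 ⟨hx, h⟩)
    grind
  · have h1 := fun h : x ∉ K => hg x (mem_sdiff.2 ⟨hx, h⟩)
    have h2 := fun h : y ∉ K => hg y (mem_sdiff.2 ⟨hy, h⟩)
    by_cases hxK : x ∈ K <;> by_cases hyK : y ∈ K <;> simp only [hxK, hyK, if_true, if_false] at hxy
    · exact hK x hxK y hyK
    · have := h2 hyK
      omega
    · have := h1 hxK
      omega
    · exact hg' x (mem_sdiff.2 ⟨hx, hxK⟩) y (mem_sdiff.2 ⟨hy, hyK⟩) hxy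

/-- Averaging: if every `i ∈ J` is related to at least a `1 / m` fraction of the elements of `Ω`,
then some element of `Ω` is related to at least a `1 / m` fraction of `J`. -/
theorem exists_card_le_mul_card_filter {ι Ω : Type*} [Fintype Ω] [Nonempty Ω] (J : Finset ι)
    (R : ι → Ω → Prop) [∀ i, DecidablePred (R i)] [∀ ω, DecidablePred fun i => R i ω] (m : ℕ)
    (hR : ∀ i ∈ J, Fintype.card Ω ≤ (univ.filter (R i)).card * m) :
    ∃ ω, J.card ≤ m * (J.filter fun i => R i ω).card := by
  by_contra! hcon
  have h1 : J.card * Fintype.card Ω ≤ (∑ i ∈ J, (univ.filter (R i)).card) * m := by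
    rw [sum_mul, ← smul_eq_mul]
    exact card_nsmul_le_sum J _ _ hR
  have h2 : ∑ i ∈ J, (univ.filter (R i)).card
      = ∑ ω : Ω, (J.filter fun i => R i ω).card :=
    sum_card_bipartiteAbove_eq_sum_card_bipartiteBelow R
  have h3 : ∑ ω : Ω, m * (J.filter fun i => R i ω).card < ∑ _ω : Ω, J.card :=
    sum_lt_sum_of_nonempty univ_nonempty fun ω _ => hcon ω
  rw [← mul_sum, ← h2, sum_const, card_univ, smul_eq_mul] at h3
  nlinarith

/-- Greedy selection: if every closed neighbourhood of a symmetric relation on `J` has at most `D`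
elements, then `J` has an independent subset of size at least `|J| / D`. -/
theorem exists_independent_card {ι : Type*} [DecidableEq ι] (J : Finset ι) (R : ι → ι → Prop)
    [DecidableRel R] (hsymm : ∀ i j, R i j → R j i) (D : ℕ)
    (hD : ∀ i ∈ J, (J.filter fun j => j = i ∨ R i j).card ≤ D) :
    ∃ I ⊆ J, (∀ i ∈ I, ∀ j ∈ I, i ≠ j → ¬ R i j) ∧ J.card ≤ I.card * D := by
  let Q := J.powerset.filter fun I => ∀ i ∈ I, ∀ j ∈ I, i ≠ j → ¬ R i j
  have hQ : Q.Nonempty := ⟨∅, by simp [Q]⟩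
  obtain ⟨I, hI, hmax⟩ := Q.exists_max_image card hQ
  obtain ⟨hIJ, hind⟩ := mem_filter.1 hI
  rw [mem_powerset] at hIJ
  refine ⟨I, hIJ, hind, ?_⟩
  have hcover : J ⊆ I.biUnion fun i => J.filter fun j => j = i ∨ R i j := by
    intro j hj
    by_contra hcon
    simp only [mem_biUnion, mem_filter, hj, true_and, not_exists, not_and, not_or] at hcon
    have hjI : j ∉ I := fun h => (hcon j h).1 rfl
    have := hmax (insert j I) (mem_filter.2 ⟨mem_powerset.2 (insert_subset hj hIJ), ?_⟩)
    · rw [card_insert_of_notMem hjI] at this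
      omega
    · intro x hx y hy hxy hR
      rcases mem_insert.1 hx with rfl | hx' <;> rcases mem_insert.1 hy with rfl | hy'
      · exact hxy rfl
      · exact (hcon y hy').2 (hsymm _ _ hR)
      · exact (hcon x hx').2 hR
      · exact hind x hx' y hy' hxy hR
  exact (card_le_card hcover).trans (card_biUnion_le_card_mul _ _ _ fun i hi => hD i (hIJ hi))

/-- An injective map to a linear order ranks the elements of a finite type. -/
theorem exists_rank_equiv {T γ : Type*} [Fintype T] [LinearOrder γ] (g : T → γ)
    (hg : Function.Injective g) :
    ∃ e : T ≃ Fin (Fintype.card T), ∀ x y, e x < e y ↔ g x < g y := by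
  let := LinearOrder.lift' g hg
  let e := (Fintype.orderIsoFinOfCardEq T rfl).symm
  exact ⟨e.toEquiv, fun x y => e.lt_iff_lt⟩

/-- At least a `1 / |T|!` fraction of all permutations arranges the elements of `T` in a
prescribed order. -/
theorem card_perm_le_card_sorted_mul {V β : Type*} [Fintype V] [DecidableEq V] [LinearOrder β]
    (u : V → β) (hu : Function.Injective u) (T : Finset V) (r : V → ℕ) (hr : Set.InjOn r T)
    [DecidablePred fun σ : Equiv.Perm V => ∀ x ∈ T, ∀ y ∈ T, u (σ x) < u (σ y) → r x < r y] :
    Fintype.card (Equiv.Perm V) ≤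
      (univ.filter fun σ : Equiv.Perm V =>
        ∀ x ∈ T, ∀ y ∈ T, u (σ x) < u (σ y) → r x < r y).card * T.card.factorial := by
  have key : ∀ σ : Equiv.Perm V, ∃ τ : Equiv.Perm {x // x ∈ T},
      ∀ x ∈ T, ∀ y ∈ T, u ((σ * Equiv.Perm.ofSubtype τ) x) <
        u ((σ * Equiv.Perm.ofSubtype τ) y) → r x < r y := by
    intro σ
    obtain ⟨e₁, h₁⟩ := exists_rank_equiv (fun x : {x // x ∈ T} => r x)
      fun x y hxy => Subtype.ext (hr x.2 y.2 hxy)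
    obtain ⟨e₂, h₂⟩ := exists_rank_equiv (fun x : {x // x ∈ T} => u (σ x))
      fun x y hxy => Subtype.ext (σ.injective (hu hxy))
    refine ⟨e₁.trans e₂.symm, fun x hx y hy hxy => ?_⟩
    rw [Equiv.Perm.mul_apply, Equiv.Perm.mul_apply, Equiv.Perm.ofSubtype_apply_of_mem _ hx,
      Equiv.Perm.ofSubtype_apply_of_mem _ hy, ← h₂] at hxy
    simpa [h₁] using hxy
  choose τ hτ using key
  have hcard : T.card.factorial = (univ : Finset (Equiv.Perm {x // x ∈ T})).card := by
    rw [card_univ, Fintype.card_perm, Fintype.card_coe]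
  rw [hcard, ← card_product, ← card_univ]
  refine card_le_card_of_injOn (fun σ => (σ * Equiv.Perm.ofSubtype (τ σ), τ σ)) ?_ ?_
  · intro σ _
    simpa using hτ σ
  · intro σ _ σ' _ h
    simp only [Prod.mk.injEq] at h
    rw [h.2] at h
    exact mul_right_cancel h.1

/-- At least a `1 / m ^ |T|` fraction of all `m`-colourings takes prescribed values on `T`. -/
theorem card_fun_le_card_agree_mul {V : Type*} [Fintype V] [DecidableEq V] (m : ℕ) (T : Finset V)
    (g : V → Fin m) [DecidablePred fun c : V → Fin m => ∀ x ∈ T, c x = g x] :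
    Fintype.card (V → Fin m) ≤
      (univ.filter fun c : V → Fin m => ∀ x ∈ T, c x = g x).card * m ^ T.card := by
  have hcard : m ^ T.card = (univ : Finset ({x // x ∈ T} → Fin m)).card := by
    rw [card_univ, Fintype.card_fun, Fintype.card_coe, Fintype.card_fin]
  rw [hcard, ← card_product, ← card_univ]
  refine card_le_card_of_injOn
    (fun c => (fun x => if x ∈ T then g x else c x, fun x => c x)) ?_ ?_
  · intro c _
    simp +contextual
  · intro c _ c' _ h
    simp only [Prod.mk.injEq] at h
    funext x
    by_cases hx : x ∈ T
    · exact congrFun h.2 ⟨x, hx⟩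
    · simpa [hx] using congrFun h.1 x

namespace IsContinuousChain

variable {α : Type*} [DecidableEq α] {C : Finset (Finset α)}

theorem exists_enum (hC : IsContinuousChain C) :
    ∃ f : ℕ → Finset α, (∀ n < C.card, f n ∈ C) ∧ (∀ A ∈ C, ∃ n < C.card, f n = A) ∧
      ∀ m n, m ≤ n → n < C.card → f m ⊆ f n ∧ (f n).card = (f m).card + (n - m) := by
  obtain ⟨f, h1, h2, h3⟩ := hC
  refine ⟨f, h1, h2, fun m n hmn hn => ?_⟩
  induction n, hmn using Nat.le_induction with
  | base => simp
  | succ n hmn ih =>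
    obtain ⟨h4, h5⟩ := ih (by omega)
    obtain ⟨h6, h7⟩ := h3 n hn
    exact ⟨h4.trans h6, by omega⟩

theorem subset_or_subset (hC : IsContinuousChain C) {A B : Finset α} (hA : A ∈ C) (hB : B ∈ C) :
    A ⊆ B ∨ B ⊆ A := by
  obtain ⟨f, h1, h2, h3⟩ := hC.exists_enum
  obtain ⟨m, hm, rfl⟩ := h2 A hA
  obtain ⟨n, hn, rfl⟩ := h2 B hB
  rcases le_total m n with h | h
  · exact Or.inl (h3 m n h hn).1
  · exact Or.inr (h3 n m h hm).1

theorem subset_of_card_le (hC : IsContinuousChain C) {A B : Finset α} (hA : A ∈ C) (hB : B ∈ C)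
    (h : A.card ≤ B.card) : A ⊆ B := by
  rcases hC.subset_or_subset hA hB with h' | h'
  · exact h'
  · exact (eq_of_subset_of_card_le h' h).ge

theorem exists_bot_top (hC : IsContinuousChain C) (hne : 0 < C.card) :
    ∃ B ∈ C, ∃ T ∈ C, (∀ A ∈ C, B ⊆ A ∧ A ⊆ T) ∧ T.card + 1 = B.card + C.card := by
  obtain ⟨f, h1, h2, h3⟩ := hC.exists_enum
  refine ⟨f 0, h1 0 hne, f (C.card - 1), h1 _ (by omega), fun A hA => ?_, ?_⟩
  · obtain ⟨m, hm, rfl⟩ := h2 A hA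
    exact ⟨(h3 0 m (by omega) hm).1, (h3 m _ (by omega) (by omega)).1⟩
  · have := (h3 0 (C.card - 1) (by omega) (by omega)).2
    omega

theorem insert_mem (hC : IsContinuousChain C) {A : Finset α} {x : α} (hA : A ∈ C) (hxA : x ∉ A)
    (hmax : ∀ B ∈ C, x ∉ B → B ⊆ A) (hx : ∃ B ∈ C, x ∈ B) : insert x A ∈ C := by
  obtain ⟨f, h1, h2, h3⟩ := hC.exists_enum
  obtain ⟨n, hn, rfl⟩ := h2 A hA
  obtain ⟨B, hB, hxB⟩ := hx
  obtain ⟨m, hm, rfl⟩ := h2 B hB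
  have hnm : n < m := by
    by_contra! h
    exact hxA ((h3 m n h hn).1 hxB)
  obtain ⟨h4, h5⟩ := h3 n (n + 1) (by omega) (by omega)
  have hxf : x ∈ f (n + 1) := by
    by_contra h
    have := card_le_card (hmax _ (h1 (n + 1) (by omega)) h)
    omega
  have : insert x (f n) = f (n + 1) := by
    apply eq_of_subset_of_card_le (insert_subset hxf h4)
    rw [card_insert_of_notMem hxA]
    omega
  exact this ▸ h1 (n + 1) (by omega)

end IsContinuousChain

namespace WeaklyCrossFreeFam

variable {α : Type*} [DecidableEq α] {k : ℕ} {F : Finset (Finset α)}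

/-- Members of a weakly-`(k+1)`-cross-free family sharing an element contain no antichain of more
than `k` sets. -/
theorem card_le_of_antichain (hF : WeaklyCrossFreeFam (k + 1) F) {S : Finset (Finset α)} {x : α}
    (hS : S ⊆ F) (hx : ∀ A ∈ S, x ∈ A) (hanti : IsAntichain (· ≤ ·) (S : Set (Finset α))) :
    S.card ≤ k := by
  by_contra! hcard
  obtain ⟨T, hT, hTk⟩ := exists_subset_card_eq (Nat.succ_le_of_lt hcard)
  refine hF ⟨T, hT.trans hS, hTk, fun A hA B hB hAB => ⟨⟨x, ?_⟩, ?_, ?_⟩⟩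
  · exact mem_inter.2 ⟨hx A (hT hA), hx B (hT hB)⟩
  · exact sdiff_nonempty.2 (hanti (hT hA) (hT hB) hAB)
  · exact sdiff_nonempty.2 (hanti (hT hB) (hT hA) hAB.symm)

theorem card_filter_card_lt_le (hF : WeaklyCrossFreeFam (k + 1) F) {X : Finset α}
    (hFX : ∀ A ∈ F, A ⊆ X) (M : ℕ) :
    (F.filter fun A => A.card < M).card ≤ X.card * M * k + 1 := by
  have hcover : (F.filter fun A => A.card < M) ⊆
      insert ∅ ((X ×ˢ range M).biUnion fun p => F.filter fun A => p.1 ∈ A ∧ A.card = p.2) := by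
    intro A hA
    obtain ⟨hAF, hAM⟩ := mem_filter.1 hA
    rcases A.eq_empty_or_nonempty with rfl | ⟨x, hx⟩
    · exact mem_insert_self _ _
    · refine mem_insert_of_mem (mem_biUnion.2 ⟨(x, A.card), ?_, ?_⟩)
      · exact mem_product.2 ⟨hFX A hAF hx, mem_range.2 hAM⟩
      · exact mem_filter.2 ⟨hAF, hx, rfl⟩
  refine (card_le_card hcover).trans ((card_insert_le _ _).trans ?_)
  gcongr
  have : X.card * M = (X ×ˢ range M).card := by rw [card_product, card_range]
  rw [this]
  refine card_biUnion_le_card_mul _ _ _ fun p _ => ?_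
  refine hF.card_le_of_antichain (x := p.1) (filter_subset _ _)
    (fun A hA => (mem_filter.1 hA).2.1) ?_
  intro A hA B hB hAB hle
  have hA := (mem_filter.1 (mem_coe.1 hA)).2.2
  have hB := (mem_filter.1 (mem_coe.1 hB)).2.2
  exact hAB (eq_of_subset_of_card_le hle (by omega))

end WeaklyCrossFreeFam

theorem mul_pow_le_succ_pow_succ (m h : ℕ) : h * m ^ h ≤ (m + 1) ^ (h + 1) := by
  induction h with
  | zero => simp
  | succ h ih =>
    have : m ^ (h + 1) ≤ (m + 1) ^ (h + 1) := Nat.pow_le_pow_left (by omega) _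
    calc (h + 1) * m ^ (h + 1) = m * (h * m ^ h) + m ^ (h + 1) := by ring
      _ ≤ m * (m + 1) ^ (h + 1) + (m + 1) ^ (h + 1) := by gcongr
      _ = (m + 1) ^ (h + 1 + 1) := by ring

set_option maxHeartbeats 800000 in
/-- Given at least `α·n` pairwise disjoint continuous chains of size `h + 1` in a
weakly-`k`-cross-free family (with `h = (2k)^{2k²+1}` and `α = 32·(h+2)!·k^{h+2}`),
one can select at least `(kh+1)·n` of them satisfying the regularity conditions
**C1**–**C4** with respect to some linear order `≺` on the ground set. -/
theorem chain_regularization {α : Type*} [DecidableEq α] {ι : Type*}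
    (k h a : ℕ) (hk : 3 ≤ k)
    (hh : h = (2 * k) ^ (2 * k ^ 2 + 1))
    (ha : a = 32 * Nat.factorial (h + 2) * k ^ (h + 2))
    (X : Finset α) (hn : 1 ≤ X.card)
    (F : Finset (Finset α)) (hFX : ∀ A ∈ F, A ⊆ X)
    (hF : WeaklyCrossFreeFam k F)
    (I₀ : Finset ι) (C : ι → Finset (Finset α))
    (hCF : ∀ i ∈ I₀, C i ⊆ F)
    (hCcard : ∀ i ∈ I₀, (C i).card = h + 1)
    (hCchain : ∀ i ∈ I₀, IsContinuousChain (C i))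
    (hCdisj : ∀ i ∈ I₀, ∀ j ∈ I₀, i ≠ j → Disjoint (C i) (C j))
    (hI₀ : a * X.card ≤ I₀.card)
    -- `Xs i` is the set of the `h` added elements of the chain `C i`, i.e. the
    -- difference between the largest and the smallest member of `C i`:
    (Xs : ι → Finset α)
    (hXs : ∀ i ∈ I₀, ∀ x : α,
      x ∈ Xs i ↔ ((∃ A ∈ C i, x ∈ A) ∧ (∃ A ∈ C i, x ∉ A)))
    -- for `x ∈ Xs i`, `Cx i x` is the largest member of `C i` not containing `x`:
    (Cx : ι → α → Finset α)
    (hCx : ∀ i ∈ I₀, ∀ x ∈ Xs i, Cx i x ∈ C i ∧ x ∉ Cx i x ∧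
      ∀ B ∈ C i, x ∉ B → B ⊆ Cx i x) :
    ∃ I : Finset ι, I ⊆ I₀ ∧ (k * h + 1) * X.card ≤ I.card ∧
      ∃ lt : α → α → Prop, IsStrictTotalOrder α lt ∧
        -- C1
        (∀ i ∈ I, ∀ j ∈ I, ∀ x : α, x ∈ Xs i → x ∈ Xs j →
          Cx i x ⊆ Cx j x ∨ Cx j x ⊆ Cx i x) ∧
        -- C2
        (∀ i ∈ I, ∀ x ∈ Xs i, ∀ y ∈ Xs i, lt x y → Cx i x ⊆ Cx i y) ∧
        -- C3
        (∀ i ∈ I, ∀ j ∈ I, i ≠ j → (Xs i ∩ Xs j).Nonempty →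
          (∀ A ∈ C i, ∀ B ∈ C j, A.card < B.card) ∨
          (∀ A ∈ C j, ∀ B ∈ C i, A.card < B.card)) ∧
        -- C4
        (∀ i ∈ I, ∀ A ∈ C i, 3 * k * h ≤ A.card) := by
  classical
  obtain ⟨w, rfl⟩ : ∃ w, k = w + 2 := ⟨k - 2, by omega⟩
  have hh1 : 1 ≤ h := hh ▸ Nat.one_le_pow _ _ (by omega)
  clear hh
  have hsub : ∀ i ∈ I₀, ∀ A ∈ C i, A ⊆ X := fun i hi A hA => hFX A (hCF i hi hA)
  have hXsX : ∀ i ∈ I₀, Xs i ⊆ X := by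
    intro i hi x hx
    obtain ⟨⟨A, hA, hxA⟩, _⟩ := (hXs i hi x).1 hx
    exact hsub i hi A hA hxA
  have hins : ∀ i ∈ I₀, ∀ x ∈ Xs i, insert x (Cx i x) ∈ C i := fun i hi x hx =>
    (hCchain i hi).insert_mem (hCx i hi x hx).1 (hCx i hi x hx).2.1 (hCx i hi x hx).2.2
      ((hXs i hi x).1 hx).1
  have hXscard : ∀ i ∈ I₀, (Xs i).card ≤ h := by
    intro i hi
    obtain ⟨B, hB, T, hT, hBT, hcard⟩ :=
      (hCchain i hi).exists_bot_top (by rw [hCcard i hi]; omega)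
    have hss : Xs i ⊆ T \ B := by
      intro x hx
      obtain ⟨⟨A, hA, hxA⟩, A', hA', hxA'⟩ := (hXs i hi x).1 hx
      exact mem_sdiff.2 ⟨(hBT A hA).2 hxA, fun h => hxA' ((hBT A' hA').1 h)⟩
    have h1 := card_le_card hss
    rw [card_sdiff_of_subset (hBT B hB).2] at h1
    rw [hCcard i hi] at hcard
    omega
  -- Discard the chains with small members.
  let J := I₀.filter fun i => ∀ A ∈ C i, 3 * (w + 2) * h ≤ A.card
  have hJI : ∀ i ∈ J, i ∈ I₀ := fun i hi => (mem_filter.1 hi).1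
  have hJcard : a * X.card ≤ 2 * J.card := by
    have hbad : (I₀.filter fun i => ¬ ∀ A ∈ C i, 3 * (w + 2) * h ≤ A.card).card ≤
        (F.filter fun A => A.card < 3 * (w + 2) * h).card := by
      have : ∀ i, ∃ A, i ∈ (I₀.filter fun i => ¬ ∀ A ∈ C i, 3 * (w + 2) * h ≤ A.card) →
          A ∈ C i ∧ A.card < 3 * (w + 2) * h := by
        intro i
        by_cases hi : ∀ A ∈ C i, 3 * (w + 2) * h ≤ A.card
        · exact ⟨∅, fun h => absurd hi (mem_filter.1 h).2⟩
        · push Not at hi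
          obtain ⟨A, hA⟩ := hi
          exact ⟨A, fun _ => hA⟩
      choose A hA using this
      refine card_le_card_of_injOn A (fun i hi => ?_) (fun i hi j hj hij => ?_)
      · exact mem_coe.2 (mem_filter.2 ⟨hCF i (mem_filter.1 hi).1 (hA i hi).1, (hA i hi).2⟩)
      · by_contra hne
        exact disjoint_left.1 (hCdisj i (mem_filter.1 hi).1 j (mem_filter.1 hj).1 hne)
          (hA i hi).1 (hij ▸ (hA j hj).1)
    have hsmall := hF.card_filter_card_lt_le hFX (3 * (w + 2) * h)
    have hsplit := card_filter_add_card_filter_not (s := I₀)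
      (fun i => ∀ A ∈ C i, 3 * (w + 2) * h ≤ A.card)
    have ha' : 2 * (3 * (w + 2) * h * (w + 1) + 1) ≤ a := by
      have h1 : h + 2 ≤ Nat.factorial (h + 2) := Nat.self_le_factorial _
      have h2 : (w + 2) ^ 2 ≤ (w + 2) ^ (h + 2) := Nat.pow_le_pow_right (by omega) (by omega)
      calc 2 * (3 * (w + 2) * h * (w + 1) + 1) ≤ 32 * (h + 2) * (w + 2) ^ 2 := by nlinarith
        _ ≤ a := by rw [ha]; gcongr
    have h3 := Nat.mul_le_mul_right X.card ha'
    change _ ≤ 2 * (I₀.filter fun i => ∀ A ∈ C i, 3 * (w + 2) * h ≤ A.card).card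
    nlinarith
  let V := {x // x ∈ X}
  let T : ι → Finset V := fun i => (Xs i).subtype (· ∈ X)
  have hT : ∀ i, ∀ v : V, v ∈ T i ↔ v.1 ∈ Xs i := fun i v => mem_subtype
  have hTcard : ∀ i ∈ I₀, (T i).card ≤ h := fun i hi => by
    rw [card_subtype]
    exact (card_filter_le _ _).trans (hXscard i hi)
  let u : α ↪ Cardinal := embeddingToCardinal
  -- Choose a linear order respected by many chains.
  obtain ⟨σ, hσ⟩ := exists_card_le_mul_card_filter J
    (fun i (σ : Equiv.Perm V) => ∀ x ∈ T i, ∀ y ∈ T i, u (σ x) < u (σ y) →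
      (Cx i x.1).card < (Cx i y.1).card) h.factorial (fun i hi => by
    refine (card_perm_le_card_sorted_mul (fun v : V => u v.1)
      (u.injective.comp Subtype.val_injective) (T i) (fun x => (Cx i x.1).card) ?_).trans ?_
    · intro x hx y hy hxy
      have hi := hJI i hi
      have hx := (hT i x).1 hx
      have hy := (hT i y).1 hy
      have hx' := hCx i hi _ hx
      have hy' := hCx i hi _ hy
      have heq : Cx i x.1 = Cx i y.1 := Subset.antisymm
        ((hCchain i hi).subset_of_card_le hx'.1 hy'.1 hxy.le)
        ((hCchain i hi).subset_of_card_le hy'.1 hx'.1 hxy.ge)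
      have heq' := (hCchain i hi).subset_of_card_le (hins i hi _ hx) (hins i hi _ hy) (by
        rw [card_insert_of_notMem hx'.2.1, card_insert_of_notMem hy'.2.1]
        exact Nat.succ_le_succ hxy.le)
      rcases mem_insert.1 (heq' (mem_insert_self _ _)) with h | h
      · exact Subtype.ext h
      · exact absurd (heq ▸ h) hx'.2.1
    · exact Nat.mul_le_mul_left _ (Nat.factorial_le (hTcard i (hJI i hi))))
  set J₁ := J.filter fun i => ∀ x ∈ T i, ∀ y ∈ T i, u (σ x) < u (σ y) →
      (Cx i x.1).card < (Cx i y.1).card with hJ₁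
  have hJ₁J : ∀ i ∈ J₁, i ∈ J := fun i hi => (mem_filter.1 hi).1
  -- Split the members of `F` growing by `x` into chains, for each `x`.
  have hcol : ∀ x : α, ∃ f : Finset α → Fin (w + 1), ∀ A ∈ F, ∀ B ∈ F, x ∈ A → x ∈ B →
      f A = f B → A ⊆ B ∨ B ⊆ A := by
    intro x
    obtain ⟨f, hf, hf'⟩ := exists_chain_coloring (F.filter fun A => x ∈ A) (w + 1)
      fun S hS hSa => hF.card_le_of_antichain (hS.trans (filter_subset _ _))
        (fun A hA => (mem_filter.1 (hS hA)).2) hSa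
    refine ⟨fun A => Fin.ofNat (w + 1) (f A), fun A hA B hB hxA hxB hAB => ?_⟩
    have hA : A ∈ F.filter fun A => x ∈ A := mem_filter.2 ⟨hA, hxA⟩
    have hB : B ∈ F.filter fun A => x ∈ A := mem_filter.2 ⟨hB, hxB⟩
    have := congrArg Fin.val hAB
    simp only [Fin.ofNat, Nat.mod_eq_of_lt (hf A hA), Nat.mod_eq_of_lt (hf B hB)] at this
    exact hf' A hA B hB this
  choose f hf using hcol
  -- Choose for each `x` a chain so that many of the `C i` only use the chosen chains.
  obtain ⟨c, hc⟩ := exists_card_le_mul_card_filter J₁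
    (fun i (c : V → Fin (w + 1)) => ∀ x ∈ T i, c x = f x.1 (insert x.1 (Cx i x.1)))
    ((w + 1) ^ h) (fun i hi =>
      (card_fun_le_card_agree_mul (w + 1) (T i) _).trans
        (Nat.mul_le_mul_left _ (Nat.pow_le_pow_right (by omega) (hTcard i (hJI i (hJ₁J i hi))))))
  set J₂ := J₁.filter fun i => ∀ x ∈ T i, c x = f x.1 (insert x.1 (Cx i x.1)) with hJ₂
  have hJ₂J : ∀ i ∈ J₂, i ∈ J₁ := fun i hi => (mem_filter.1 hi).1
  have hJ₂I : ∀ i ∈ J₂, i ∈ I₀ := fun i hi => hJI i (hJ₁J i (hJ₂J i hi))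
  have hC1 : ∀ i ∈ J₂, ∀ j ∈ J₂, ∀ x : α, x ∈ Xs i → x ∈ Xs j →
      Cx i x ⊆ Cx j x ∨ Cx j x ⊆ Cx i x := by
    intro i hi j hj x hxi hxj
    have hi' := hJ₂I i hi
    have hj' := hJ₂I j hj
    have hxX := hXsX i hi' hxi
    have h1 := (mem_filter.1 hi).2 ⟨x, hxX⟩ ((hT i _).2 hxi)
    have h2 := (mem_filter.1 hj).2 ⟨x, hxX⟩ ((hT j _).2 hxj)
    have h3 := hf x _ (hCF i hi' (hins i hi' x hxi)) _ (hCF j hj' (hins j hj' x hxj))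
      (mem_insert_self _ _) (mem_insert_self _ _) (h1.symm.trans h2)
    rwa [insert_subset_insert_iff (hCx i hi' x hxi).2.1,
      insert_subset_insert_iff (hCx j hj' x hxj).2.1] at h3
  -- Pass to an independent set of the graph of pairs violating C3.
  let R : ι → ι → Prop := fun i j => (Xs i ∩ Xs j).Nonempty ∧
    (∃ A ∈ C i, ∃ B ∈ C j, B.card ≤ A.card) ∧ (∃ A ∈ C j, ∃ B ∈ C i, B.card ≤ A.card)
  obtain ⟨I, hIJ, hI, hIcard⟩ := exists_independent_card J₂ R
    (fun i j h => ⟨inter_comm (Xs i) (Xs j) ▸ h.1, h.2.2, h.2.1⟩) (h * (3 * h + 1)) (by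
    intro i hi
    have hi' := hJ₂I i hi
    obtain ⟨B, hB, U, hU, hBU, hUcard⟩ :=
      (hCchain i hi').exists_bot_top (by rw [hCcard i hi']; omega)
    have hne : (Xs i).Nonempty := by
      rw [hCcard i hi'] at hUcard
      obtain ⟨x, hxU, hxB⟩ := exists_mem_notMem_of_card_lt_card (s := B) (t := U) (by omega)
      exact ⟨x, (hXs i hi' x).2 ⟨⟨U, hU, hxU⟩, B, hB, hxB⟩⟩
    have hcover : (J₂.filter fun j => j = i ∨ R i j) ⊆
        (Xs i ×ˢ range (3 * h + 1)).biUnion fun p => J₂.filter fun j =>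
          p.1 ∈ Xs j ∧ (Cx j p.1).card + h = B.card + p.2 := by
      intro j hj
      obtain ⟨hj, hij⟩ := mem_filter.1 hj
      have hj' := hJ₂I j hj
      have hij' : R i j := by
        rcases hij with rfl | hij
        · exact ⟨by rwa [inter_self], ⟨B, hB, B, hB, le_rfl⟩, B, hB, B, hB, le_rfl⟩
        · exact hij
      obtain ⟨⟨x, hx⟩, ⟨A₁, hA₁, A₂, hA₂, h12⟩, A₃, hA₃, A₄, hA₄, h34⟩ := hij'
      obtain ⟨hxi, hxj⟩ := mem_inter.1 hx
      obtain ⟨B', hB', U', hU', hBU', hUcard'⟩ :=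
        (hCchain j hj').exists_bot_top (by rw [hCcard j hj']; omega)
      rw [hCcard j hj'] at hUcard'
      rw [hCcard i hi'] at hUcard
      have hm := (hCx j hj' x hxj).1
      have e1 := card_le_card (hBU A₁ hA₁).2
      have e2 := card_le_card (hBU' A₂ hA₂).1
      have e3 := card_le_card (hBU' A₃ hA₃).2
      have e4 := card_le_card (hBU A₄ hA₄).1
      have e5 := card_le_card (hBU' _ hm).1
      have e6 := card_le_card (hBU' _ hm).2
      refine mem_biUnion.2 ⟨(x, (Cx j x).card + h - B.card), mem_product.2 ⟨hxi, ?_⟩,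
        mem_filter.2 ⟨hj, hxj, ?_⟩⟩
      · simp only [mem_range]
        omega
      · simp only
        omega
    refine (card_le_card hcover).trans ((card_biUnion_le_card_mul _ _ 1 ?_).trans ?_)
    · intro p _
      rw [card_le_one]
      intro j hj l hl
      obtain ⟨hj, hxj, hsj⟩ := mem_filter.1 hj
      obtain ⟨hl, hxl, hsl⟩ := mem_filter.1 hl
      have heq : Cx j p.1 = Cx l p.1 := by
        rcases hC1 j hj l hl p.1 hxj hxl with h | h
        · exact eq_of_subset_of_card_le h (by omega)
        · exact (eq_of_subset_of_card_le h (by omega)).symm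
      by_contra hjl
      exact disjoint_left.1 (hCdisj j (hJ₂I j hj) l (hJ₂I l hl) hjl)
        (hCx j (hJ₂I j hj) _ hxj).1 (heq ▸ (hCx l (hJ₂I l hl) _ hxl).1)
    · rw [card_product, card_range, mul_one]
      exact Nat.mul_le_mul_right _ (hXscard i hi'))
  refine ⟨I, fun i hi => hJ₂I i (hIJ hi), ?_, ?_⟩
  · have hpow := mul_pow_le_succ_pow_succ (w + 1) h
    have hpos : 0 < 2 * h.factorial * (w + 1) ^ h * h := by positivity
    have hlow : 32 * (h + 2) * (h + 1) * h.factorial * (w + 2) * (h * (w + 1) ^ h) ≤ a := by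
      rw [ha, Nat.factorial_succ, Nat.factorial_succ]
      calc _ ≤ 32 * (h + 2) * (h + 1) * h.factorial * (w + 2) * (w + 1 + 1) ^ (h + 1) := by gcongr
        _ = _ := by ring
    have hup : a * X.card ≤ 2 * (h.factorial * ((w + 1) ^ h * (I.card * (h * (3 * h + 1))))) := by
      refine hJcard.trans (Nat.mul_le_mul_left _ (hσ.trans (Nat.mul_le_mul_left _ ?_)))
      exact hc.trans (Nat.mul_le_mul_left _ hIcard)
    have hmain : 16 * (h + 2) * (h + 1) * (w + 2) * X.card ≤ (3 * h + 1) * I.card := by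
      refine Nat.le_of_mul_le_mul_left ?_ hpos
      calc _ = 32 * (h + 2) * (h + 1) * h.factorial * (w + 2) * (h * (w + 1) ^ h) * X.card := by
            ring
        _ ≤ a * X.card := Nat.mul_le_mul_right _ hlow
        _ ≤ _ := hup
        _ = _ := by ring
    refine Nat.le_of_mul_le_mul_left (hmain.trans' ?_) (show 0 < 3 * h + 1 by omega)
    rw [← mul_assoc]
    refine Nat.mul_le_mul_right _ ?_
    calc (3 * h + 1) * ((w + 2) * h + 1) ≤ (16 * (h + 1)) * ((w + 2) * (h + 2)) := by
          gcongr
          · omega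
          · nlinarith
      _ = _ := by ring
  · let s := Equiv.Perm.ofSubtype σ
    refine ⟨fun x y => u (s x) < u (s y), ?_, fun i hi j hj => hC1 i (hIJ hi) j (hIJ hj), ?_, ?_, ?_⟩
    · exact
        { irrefl := fun x => lt_irrefl _
          trans := fun x y z => lt_trans
          trichotomous := fun x y h1 h2 =>
            s.injective <| u.injective (le_antisymm (not_lt.1 h2) (not_lt.1 h1)) }
    · intro i hi x hx y hy hxy
      have hi' := hJ₂I i (hIJ hi)
      have hxX := hXsX i hi' hx
      have hyX := hXsX i hi' hy
      simp only [s, Equiv.Perm.ofSubtype_apply_of_mem σ hxX,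
        Equiv.Perm.ofSubtype_apply_of_mem σ hyX] at hxy
      have := (mem_filter.1 (hJ₂J i (hIJ hi))).2 ⟨x, hxX⟩ ((hT i _).2 hx) ⟨y, hyX⟩
        ((hT i _).2 hy) hxy
      exact (hCchain i hi').subset_of_card_le (hCx i hi' x hx).1 (hCx i hi' y hy).1 this.le
    · intro i hi j hj hij hne
      by_contra! hcon
      obtain ⟨⟨A, hA, B, hB, hAB⟩, A', hA', B', hB', hAB'⟩ := hcon
      exact hI i hi j hj hij ⟨hne, ⟨A, hA, B, hB, hAB⟩, A', hA', B', hB', hAB'⟩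
    · intro i hi
      exact (mem_filter.1 (hJ₁J i (hJ₂J i (hIJ hi)))).2
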